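/- Let W = (ω₁,…,ω_r) and U = (υ₁,…,υ_r) be C(x)-vector-space bases of A that generate the same C[x]-submodule of A; equivalently, W = TU for some matrix T ∈ C[x]^{r×r} that is invertible over C[x] (i.e., T^{−1} ∈ C[x]^{r×r}). Let e_w, e_u ∈ C[x] be monic and M_w, M_u ∈ C[x]^{r×r} be such that SW = (1/e_w)·M_wW and SU = (1/e_u)·M_uU, where the gcd of e_w together with all entries of M_w equals 1 and the gcd of e_u together with all entries of M_u equals 1. Then e_w = e_u. -/

import Mathlib

set_option maxHeartbeats 1000000
set_option synthInstance.maxHeartbeats 200000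

open Polynomial Filter

noncomputable section

namespace PRec

variable (C : Type*) [Field C] [CharZero C]

/-- The algebraic closure of the coefficient field. -/
abbrev Cbar := AlgebraicClosure C

/-- The field of formal Laurent series over the algebraic closure. -/
abbrev LS := LaurentSeries (Cbar C)

/-- The Laurent-series variable `q`. -/
def qv : LS C := HahnSeries.single 1 1

open Classical in
/-- The valuation `ν_q`, with `ν_q 0 = ⊤`, valued in the extended reals. -/
def nuq (a : LS C) : EReal := if a = 0 then ⊤ else (((a.order : ℤ) : ℝ) : EReal)

/-- Evaluation of a rational function at the point `α + m + q`. -/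
def evalAt (α : Cbar C) (m : ℤ) (p : RatFunc C) : LS C :=
  RatFunc.eval ((algebraMap (Cbar C) (LS C)).comp (algebraMap C (Cbar C)))
    (algebraMap (Cbar C) (LS C) α + (m : LS C) + qv C) p

/-- Shorthand for the canonical map `C[x] → C(x)`. -/
abbrev toRat : Polynomial C →+* RatFunc C := algebraMap (Polynomial C) (RatFunc C)

variable (ℓ : ℕ → Polynomial C) (r : ℕ)

/-- The solution space `Sol_α(L)` of `L = ℓ₀ + ℓ₁ S + ⋯ + ℓ_r S^r` at `α`,
indexed so that `b n` stands for the value of the solution at `α + n`. -/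
def SolSet (α : Cbar C) : Set (ℤ → LS C) :=
  {b | ∀ n : ℤ, ∑ i ∈ Finset.range (r + 1),
      evalAt C α n (toRat C (ℓ i)) * b (n + i) = 0}

/-- The action of an element `f = f₀ + f₁ S + ⋯ + f_{r-1} S^{r-1}` of
`A = C(x)[S]/⟨L⟩` (represented by its coefficient vector) on a sequence. -/
def elemApply (α : Cbar C) (f : Fin r → RatFunc C) (b : ℤ → LS C) : ℤ → LS C :=
  fun n => ∑ i : Fin r, evalAt C α n (f i) * b (n + (i : ℤ))

/-- Truncated subtraction on extended reals with the convention `⊤ - ⊤ = ⊤`. -/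
def esub (a b : EReal) : EReal := if b = ⊤ then ⊤ else a - b

/-- The value function `val_α` on `A`. -/
def valAt (α : Cbar C) (f : Fin r → RatFunc C) : EReal :=
  ⨅ b ∈ SolSet C ℓ r α,
    esub (nuq C (elemApply C r α f b 0))
      (Filter.liminf (fun n : ℕ => nuq C (b (-(n : ℤ)))) Filter.atTop)

/-- `f ∈ A` is (locally) integral at `α`. -/
def IntegralAt (α : Cbar C) (f : Fin r → RatFunc C) : Prop :=
  0 ≤ valAt C ℓ r α f

/-- Membership in the local subring `C(x)_α` of rational functions having no pole at `α`. -/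
def InLocalRing (α : Cbar C) (f : RatFunc C) : Prop :=
  ∃ p q : Polynomial C, (Polynomial.aeval α) q ≠ 0 ∧ f = toRat C p / toRat C q

/-- `W` is a `C(x)`-vector space basis of `A` (represented on coefficient vectors). -/
def IsVSBasis (W : Fin r → (Fin r → RatFunc C)) : Prop :=
  LinearIndependent (RatFunc C) W ∧
    Submodule.span (RatFunc C) (Set.range W) = (⊤ : Submodule (RatFunc C) (Fin r → RatFunc C))

/-- The `C(x)_α`-span of a tuple of elements of `A`. -/
def localSpan (α : Cbar C) (W : Fin r → (Fin r → RatFunc C)) :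
    Set (Fin r → RatFunc C) :=
  {f | ∃ c : Fin r → RatFunc C, (∀ i, InLocalRing C α (c i)) ∧ f = ∑ i, c i • W i}

/-- `W` is a local integral basis of `A` at `α`. -/
def IsLocalIntegralBasis (α : Cbar C) (W : Fin r → (Fin r → RatFunc C)) : Prop :=
  IsVSBasis C r W ∧ (∀ i, IntegralAt C ℓ r α (W i)) ∧
    ∀ f : Fin r → RatFunc C, IntegralAt C ℓ r α f → f ∈ localSpan C r α W

/-- The standard basis `1, S, …, S^{r-1}` of `A`. -/
def stdBasis : Fin r → (Fin r → RatFunc C) :=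
  fun i j => if j = i then 1 else 0

/-- The shift automorphism `p(x) ↦ p(x+c)` of the polynomial ring. -/
def polyShiftEquiv (c : C) : Polynomial C ≃+* Polynomial C where
  toFun p := p.comp (X + Polynomial.C c)
  invFun p := p.comp (X - Polynomial.C c)
  left_inv p := by
    show (p.comp (X + Polynomial.C c)).comp (X - Polynomial.C c) = p
    rw [Polynomial.comp_assoc]; simp
  right_inv p := by
    show (p.comp (X - Polynomial.C c)).comp (X + Polynomial.C c) = p
    rw [Polynomial.comp_assoc]; simp
  map_add' p q := by simp [Polynomial.add_comp]
  map_mul' p q := by simp [Polynomial.mul_comp]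

/-- The shift `σ^k`, `p(x) ↦ p(x+k)`, on polynomials, for `k : ℤ`. -/
def polyShift (k : ℤ) (p : Polynomial C) : Polynomial C := polyShiftEquiv C (k : C) p

/-- `σ` on polynomials. -/
def polyσ : Polynomial C ≃+* Polynomial C := polyShiftEquiv C 1

/-- The shift automorphism `σ : f(x) ↦ f(x+1)` of the rational function field. -/
def ratσ : RatFunc C →+* RatFunc C :=
  RatFunc.mapRingHom (polyσ C : Polynomial C →+* Polynomial C)
    (by
      intro p hp
      simp only [Submonoid.mem_comap]
      refine mem_nonZeroDivisors_iff_ne_zero.mpr ?_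
      have hp0 : p ≠ 0 := mem_nonZeroDivisors_iff_ne_zero.mp hp
      simpa using (map_ne_zero_iff _ (polyσ C).injective).mpr hp0)

variable [NeZero r]

/-- The index `r - 1` as an element of `Fin r`. -/
def lastIdx : Fin r := ⟨r - 1, Nat.sub_lt (Nat.pos_of_ne_zero (NeZero.ne r)) one_pos⟩

/-- The action of `S` on `A = C(x)[S]/⟨L⟩`, on coefficient vectors with respect to the
basis `1, S, …, S^{r-1}`, using `S^r = -(ℓ₀/ℓ_r) - ⋯ - (ℓ_{r-1}/ℓ_r) S^{r-1}`. -/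
def Smap (f : Fin r → RatFunc C) : Fin r → RatFunc C :=
  fun j =>
    (if (j : ℕ) = 0 then 0 else
      ratσ C (f ⟨(j : ℕ) - 1, lt_of_le_of_lt (Nat.sub_le _ _) j.isLt⟩))
      - ratσ C (f (lastIdx r)) * (toRat C (ℓ j) / toRat C (ℓ r))

/-- The difference operator `Δ = S - 1` on `A`. -/
def Dmap (f : Fin r → RatFunc C) : Fin r → RatFunc C :=
  Smap C ℓ r f - f

/-- `f ∈ A` is summable. -/
def IsSummable (f : Fin r → RatFunc C) : Prop :=
  ∃ g : Fin r → RatFunc C, f = Dmap C ℓ r g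

/-- `disp_α(p) ≥ k`: `p` has two roots in `α + ℤ` at distance `k`. -/
def DispGe (α : Cbar C) (p : Polynomial (Cbar C)) (k : ℕ) : Prop :=
  ∃ m : ℤ, Polynomial.eval (α + (m : Cbar C)) p = 0 ∧
    Polynomial.eval (α + (m : Cbar C) + (k : Cbar C)) p = 0

/-- The dispersion `disp_α(p)` as an extended natural number
(`0` by convention for the empty set, which is excluded by the hypotheses below). -/
def dispVal (α : Cbar C) (p : Polynomial (Cbar C)) : ℕ∞ :=
  sSup ((fun k : ℕ => (k : ℕ∞)) '' {k : ℕ | DispGe C α p k})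

/-- A polynomial is shift-free if it is coprime to each of its nontrivial shifts. -/
def ShiftFree {K : Type*} [Field K] [CharZero K] (p : Polynomial K) : Prop :=
  ∀ k : ℤ, k ≠ 0 → IsCoprime p (p.comp (X + Polynomial.C (k : K)))


/-- If the entries of a finite family together with `e` have no common nonunit divisor and `e`
divides each `a * M i`, then `e` divides `a`. -/
theorem dvd_of_forall_dvd_mul {R ι : Type*} [CommRing R] [IsPrincipalIdealRing R]
    {e a : R} {M : ι → R}
    (hg : ∀ d, d ∣ e → (∀ i, d ∣ M i) → IsUnit d) (h : ∀ i, e ∣ a * M i) : e ∣ a := by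
  obtain ⟨d, hd⟩ := IsPrincipalIdealRing.principal (Ideal.span (insert e (Set.range M)))
  have hmem : ∀ y ∈ insert e (Set.range M), d ∣ y := fun y hy =>
    Ideal.mem_span_singleton.mp (hd ▸ Ideal.subset_span hy :)
  have hunit : IsUnit d :=
    hg d (hmem e (Set.mem_insert _ _)) fun i => hmem _ (Set.mem_insert_of_mem _ ⟨i, rfl⟩)
  have htop : Ideal.span (insert e (Set.range M)) = ⊤ :=
    hd.trans (Ideal.span_singleton_eq_top.mpr hunit)
  have hle : Ideal.span (insert e (Set.range M)) ≤ (Ideal.span {e}).colon {a} := by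
    rw [Ideal.span_le]
    rintro y (rfl | ⟨i, rfl⟩)
    · simp [Submodule.mem_colon_singleton, Ideal.mem_span_singleton]
    · simpa [Submodule.mem_colon_singleton, Ideal.mem_span_singleton, mul_comm] using h i
  have h1 : (1 : R) ∈ (Ideal.span {e}).colon {a} := hle (htop ▸ Submodule.mem_top)
  simpa [Submodule.mem_colon_singleton, Ideal.mem_span_singleton] using h1

omit [CharZero C] in
theorem ratσ_toRat (p : Polynomial C) : ratσ C (toRat C p) = toRat C (polyσ C p) := by
  simp [ratσ, RatFunc.coe_mapRingHom_eq_coe_map, RatFunc.map_apply]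

/-- The action of `S` is `σ`-semilinear. -/
theorem Smap_sum_smul {ι : Type*} (s : Finset ι) (c : ι → RatFunc C)
    (v : ι → Fin r → RatFunc C) :
    Smap C ℓ r (∑ i ∈ s, c i • v i) = ∑ i ∈ s, ratσ C (c i) • Smap C ℓ r (v i) := by
  ext j
  by_cases hj : (j : ℕ) = 0
  · simp [Smap, hj, Finset.sum_mul, mul_assoc]
  · simp [Smap, hj, Finset.sum_mul, mul_sub, Finset.sum_sub_distrib, mul_assoc]

omit [CharZero C] [NeZero r] in
/-- An invertible polynomial change of basis can be inverted. -/
theorem inverse_change_of_basis {W U : Fin r → (Fin r → RatFunc C)}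
    {T T' : Matrix (Fin r) (Fin r) (Polynomial C)} (hT'T : T' * T = 1)
    (hWTU : ∀ i, W i = ∑ j, toRat C (T i j) • U j) (i : Fin r) :
    U i = ∑ j, toRat C (T' i j) • W j := by
  simp only [hWTU, Finset.smul_sum, smul_smul, ← map_mul]
  rw [Finset.sum_comm]
  simp only [← Finset.sum_smul, ← map_sum, ← Matrix.mul_apply, hT'T, Matrix.one_apply]
  simp

/-- The change of the matrix of `S` under a change of basis over `C[x]`. -/
theorem denom_mul_eq
    {W U : Fin r → (Fin r → RatFunc C)} (hW : LinearIndependent (RatFunc C) W)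
    {T T' : Matrix (Fin r) (Fin r) (Polynomial C)} (hT'T : T' * T = 1)
    (hWTU : ∀ i, W i = ∑ j, toRat C (T i j) • U j)
    {ew eu : Polynomial C} (hew : ew ≠ 0) (heu : eu ≠ 0)
    {Mw Mu : Matrix (Fin r) (Fin r) (Polynomial C)}
    (hSW : ∀ i, Smap C ℓ r (W i) = ∑ j, (toRat C (Mw i j) / toRat C ew) • W j)
    (hSU : ∀ i, Smap C ℓ r (U i) = ∑ j, (toRat C (Mu i j) / toRat C eu) • U j) :
    eu • Mw = ew • (T.map (polyσ C) * Mu * T') := by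
  have hew' : toRat C ew ≠ 0 := RatFunc.algebraMap_ne_zero hew
  have heu' : toRat C eu ≠ 0 := RatFunc.algebraMap_ne_zero heu
  have hUW := inverse_change_of_basis C r hT'T hWTU
  ext1 i j
  have key : ∑ j, (toRat C (Mw i j) / toRat C ew) • W j
      = ∑ j, (toRat C ((T.map (polyσ C) * Mu * T') i j) / toRat C eu) • W j := by
    rw [← hSW, hWTU, Smap_sum_smul]
    simp only [hSU, ratσ_toRat]
    simp only [hUW, Finset.smul_sum, smul_smul]
    simp only [Matrix.mul_apply, map_sum, map_mul, Finset.sum_div, Finset.sum_smul,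
      Finset.sum_mul, Matrix.map_apply]
    rw [Finset.sum_congr rfl fun _ _ => Finset.sum_comm, Finset.sum_comm]
    refine Finset.sum_congr rfl fun k _ => ?_
    rw [Finset.sum_comm]
    refine Finset.sum_congr rfl fun l _ => Finset.sum_congr rfl fun m _ => ?_
    congr 1
    ring
  have h := Fintype.linearIndependent_iffₛ.mp hW _ _ key j
  rw [div_eq_div_iff hew' heu', ← map_mul, ← map_mul] at h
  simpa [mul_comm] using RatFunc.algebraMap_injective C h

theorem denom_dvd
    {W U : Fin r → (Fin r → RatFunc C)} (hW : LinearIndependent (RatFunc C) W)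
    {T T' : Matrix (Fin r) (Fin r) (Polynomial C)} (hT'T : T' * T = 1)
    (hWTU : ∀ i, W i = ∑ j, toRat C (T i j) • U j)
    {ew eu : Polynomial C} (hew : ew ≠ 0) (heu : eu ≠ 0)
    {Mw Mu : Matrix (Fin r) (Fin r) (Polynomial C)}
    (hSW : ∀ i, Smap C ℓ r (W i) = ∑ j, (toRat C (Mw i j) / toRat C ew) • W j)
    (hSU : ∀ i, Smap C ℓ r (U i) = ∑ j, (toRat C (Mu i j) / toRat C eu) • U j)
    (hgw : ∀ d : Polynomial C, d ∣ ew → (∀ i j, d ∣ Mw i j) → IsUnit d) :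
    ew ∣ eu := by
  have h := denom_mul_eq C ℓ r hW hT'T hWTU hew heu hSW hSU
  refine dvd_of_forall_dvd_mul (M := fun ij : Fin r × Fin r => Mw ij.1 ij.2)
    (fun d hd hM => hgw d hd fun i j => hM (i, j)) fun ij => ?_
  exact ⟨_, congrFun (congrFun h ij.1) ij.2⟩

theorem statement18 [NeZero r] (hr : 1 ≤ r) (hℓ : ℓ 0 * ℓ r ≠ 0)
    (W U : Fin r → (Fin r → RatFunc C))
    (hWb : IsVSBasis C r W) (hUb : IsVSBasis C r U)
    (T T' : Matrix (Fin r) (Fin r) (Polynomial C))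
    (hTT' : T * T' = 1) (hT'T : T' * T = 1)
    (hWTU : ∀ i, W i = ∑ j, toRat C (T i j) • U j)
    (ew eu : Polynomial C) (hewm : ew.Monic) (heum : eu.Monic)
    (Mw Mu : Matrix (Fin r) (Fin r) (Polynomial C))
    (hSW : ∀ i, Smap C ℓ r (W i) = ∑ j, (toRat C (Mw i j) / toRat C ew) • W j)
    (hSU : ∀ i, Smap C ℓ r (U i) = ∑ j, (toRat C (Mu i j) / toRat C eu) • U j)
    (hgw : ∀ d : Polynomial C, d ∣ ew → (∀ i j, d ∣ Mw i j) → IsUnit d)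
    (hgu : ∀ d : Polynomial C, d ∣ eu → (∀ i j, d ∣ Mu i j) → IsUnit d) :
    ew = eu := by
  have hUTW := inverse_change_of_basis C r hT'T hWTU
  exact eq_of_monic_of_associated hewm heum (associated_of_dvd_dvd
    (denom_dvd C ℓ r hWb.1 hT'T hWTU hewm.ne_zero heum.ne_zero hSW hSU hgw)
    (denom_dvd C ℓ r hUb.1 hTT' hUTW heum.ne_zero hewm.ne_zero hSU hSW hgu))

end PRec
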